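/- arXiv:math/9309207 — 2 statements merged into one kernel-verified Lean document; each statement's English description precedes it below -/
import Mathlib

section
/- Let λ be a singular strong limit cardinal of cofinality ω. Then there exists a strictly increasing sequence ⟨λ_i : i < ω⟩ of regular cardinals with supremum λ, and a sequence ⟨g_α : α < λ⁺⟩ of functions with g_α(i) < λ_i for all i < ω, such that the sequence is <*-increasing (for α < β < λ⁺, g_α(i) < g_β(i) for all but finitely many i) and <*-cofinal (for every function f with f(i) < λ_i for all i, there is α < λ⁺ such that f(i) < g_α(i) for all but finitely many i). In other words, the true cofinality of ∏_{i<ω} λ_i modulo the ideal of finite sets is λ⁺. -/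
namespace TrueCofinality

open Cardinal Ordinal Set Filter Order

universe u v w

theorem nonempty_succ_ord_toType (c : Cardinal.{u}) : Nonempty (succ c).ord.ToType := by
  rw [nonempty_toType_iff, Ne, ord_eq_zero]
  exact succ_ne_zero c

/-- A family of at most `c` elements of the well-order `c⁺` is strictly bounded. -/
theorem exists_forall_lt {c : Cardinal.{u}} (hc : ℵ₀ ≤ c) {T : Type v}
    (hT : Cardinal.lift.{u} #T ≤ Cardinal.lift.{v} c) (b : T → (succ c).ord.ToType) :
    ∃ j, ∀ t, b t < j := by
  by_contra! h
  have hcof : IsCofinal (range b) := fun j => by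
    obtain ⟨t, ht⟩ := h j
    exact ⟨_, mem_range_self t, ht⟩
  have h1 := Order.cof_le hcof
  rw [cof_toType, (isRegular_succ hc).cof_ord] at h1
  have h2 := Cardinal.mk_range_le_lift (f := b)
  have h3 := (Cardinal.lift_le.{v}.2 h1).trans (h2.trans hT)
  exact (lt_succ c).not_ge (Cardinal.lift_le.1 h3)

/-- A map on `c⁺` with at most `c` values has an unbounded fibre. -/
theorem exists_cofinal_fiber {c : Cardinal.{u}} (hc : ℵ₀ ≤ c) {T : Type v}
    (hT : Cardinal.lift.{u} #T ≤ Cardinal.lift.{v} c) {X : Type w} (F : T → X)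
    (p : (succ c).ord.ToType → X) (hp : ∀ i, ∃ t, F t = p i) :
    ∃ x, ∀ i, ∃ j, i < j ∧ p j = x := by
  by_contra! h
  choose b hb using fun t => h (F t)
  obtain ⟨j, hj⟩ := exists_forall_lt hc hT b
  obtain ⟨t, ht⟩ := hp j
  exact hb t j (hj t) ht.symm

/-- The least element of `S` which is at least `x`. -/
noncomputable def leastAbove (S : Set Ordinal.{w}) (x : Ordinal.{w}) : Ordinal.{w} :=
  sInf (S ∩ Ici x)

theorem leastAbove_mem {S : Set Ordinal.{w}} {x y : Ordinal.{w}} (hy : y ∈ S) (hxy : x ≤ y) :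
    leastAbove S x ∈ S ∧ x ≤ leastAbove S x :=
  csInf_mem (s := S ∩ Ici x) ⟨y, hy, hxy⟩

theorem leastAbove_le {S : Set Ordinal.{w}} {x y : Ordinal.{w}} (hy : y ∈ S) (hxy : x ≤ y) :
    leastAbove S x ≤ y :=
  csInf_le' ⟨hy, hxy⟩

/-- `h` is a least upper bound of the family `f` modulo finite sets. -/
structure IsLeastUpperBound {I : Type u} (f : I → ℕ → Ordinal.{w}) (h : ℕ → Ordinal.{w}) :
    Prop where
  upper : ∀ i, ∀ᶠ n in atTop, f i n ≤ h n
  least : ∀ h' : ℕ → Ordinal.{w}, (∀ i, ∀ᶠ n in atTop, f i n ≤ h' n) → ∀ᶠ n in atTop, h n ≤ h' n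

/-- The projections of an increasing sequence of length `c⁺` to countable sets stabilize, at an upper
bound of the sequence. -/
theorem exists_eventually_leastAbove_eq {c : Cardinal.{u}} (hc : 2 ^ ℵ₀ ≤ c)
    {f : (succ c).ord.ToType → ℕ → Ordinal.{w}}
    (hf : ∀ i j, i < j → ∀ᶠ n in atTop, f i n ≤ f j n)
    {top : ℕ → Ordinal.{w}} (htop : ∀ i n, f i n ≤ top n) {S : ℕ → Set Ordinal.{w}}
    (hS : ∀ n, (S n).Countable ∧ top n ∈ S n) :
    ∃ t : ℕ → Ordinal.{w}, (∀ i, ∀ᶠ n in atTop, f i n ≤ t n) ∧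
      ∃ i₀, ∀ i, i₀ ≤ i → ∀ᶠ n in atTop, leastAbove (S n) (f i n) = t n := by
  have hc0 : ℵ₀ ≤ c := (cantor _).le.trans hc
  have he : ∀ n, ∃ e : ℕ → Ordinal.{w}, S n = range e := fun n =>
    (hS n).1.exists_eq_range ⟨_, (hS n).2⟩
  choose e he using he
  have hmem := fun i n => leastAbove_mem (hS n).2 (htop i n)
  have hmono : ∀ i j, i < j → ∀ᶠ n in atTop,
      leastAbove (S n) (f i n) ≤ leastAbove (S n) (f j n) := fun i j hij => by
    filter_upwards [hf i j hij] with n hn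
    exact leastAbove_le (hmem j n).1 (hn.trans (hmem j n).2)
  obtain ⟨t, ht⟩ := exists_cofinal_fiber hc0 (T := ℕ → ℕ)
    (by simpa using hc) (fun k n => e n (k n))
    (fun i n => leastAbove (S n) (f i n)) (fun i => by
      have : ∀ n, ∃ k, e n k = leastAbove (S n) (f i n) := fun n => by
        have := (hmem i n).1
        rw [he n] at this
        rw [he n]
        exact this
      choose k hk using this
      exact ⟨k, funext hk⟩)
  have hne := nonempty_succ_ord_toType c
  obtain ⟨i₀, -, hi₀⟩ := ht hne.some
  refine ⟨t, fun i => ?_, i₀, fun i hi => ?_⟩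
  · obtain ⟨j, hij, rfl⟩ := ht i
    filter_upwards [hf i j hij] with n hn
    exact hn.trans (hmem j n).2
  · obtain ⟨j, hij, hj⟩ := ht i
    rcases hi.eq_or_lt with rfl | hlt
    · exact Eventually.of_forall fun n => congrFun hi₀ n
    · filter_upwards [hmono _ _ hlt, hmono _ _ hij] with n h1 h2
      rw [congrFun hi₀ n] at h1
      rw [congrFun hj n] at h2
      exact le_antisymm h2 h1

/-- An increasing sequence of functions of length `c⁺`, where `2 ^ ℵ₀ ≤ c`, has a least upper
bound modulo finite sets. -/
theorem exists_isLeastUpperBound {c : Cardinal.{u}} (hc : 2 ^ ℵ₀ ≤ c)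
    {f : (succ c).ord.ToType → ℕ → Ordinal.{w}}
    (hf : ∀ i j, i < j → ∀ᶠ n in atTop, f i n ≤ f j n)
    {top : ℕ → Ordinal.{w}} (htop : ∀ i n, f i n ≤ top n) :
    ∃ h, IsLeastUpperBound f h := by
  by_contra hno
  have hc0 : ℵ₀ ≤ c := (cantor _).le.trans hc
  have step : ∀ S : ℕ → Set Ordinal.{w}, ∃ h' : ℕ → Ordinal.{w}, ∃ i₀,
      (∀ n, (S n).Countable ∧ top n ∈ S n) →
      (∀ i, ∀ᶠ n in atTop, f i n ≤ h' n) ∧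
        ∀ i, i₀ ≤ i → ∃ᶠ n in atTop, h' n < leastAbove (S n) (f i n) := by
    intro S
    by_cases hS : ∀ n, (S n).Countable ∧ top n ∈ S n
    · obtain ⟨t, ht, i₀, hi₀⟩ := exists_eventually_leastAbove_eq hc hf htop hS
      obtain ⟨h', hub, hlt⟩ : ∃ h' : ℕ → Ordinal.{w}, (∀ i, ∀ᶠ n in atTop, f i n ≤ h' n) ∧
          ∃ᶠ n in atTop, h' n < t n := by
        by_contra! H
        refine hno ⟨t, ht, fun h' hh' => ?_⟩
        simpa [not_frequently] using H h' hh'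
      refine ⟨h', i₀, fun _ => ⟨hub, fun i hi => (hlt.and_eventually (hi₀ i hi)).mono ?_⟩⟩
      rintro n ⟨h1, h2⟩
      rwa [h2]
    · have hne := nonempty_succ_ord_toType c
      exact ⟨0, hne.some, fun h => absurd h hS⟩
  choose Φ i₀ hΦ using step
  obtain ⟨H, hH⟩ : ∃ H : (succ (ℵ₀ : Cardinal.{0})).ord.ToType → ℕ → Ordinal.{w},
      ∀ ν, H ν = Φ fun n => insert (top n) ((fun μ => H μ n) '' Iio ν) := by
    refine ⟨IsWellFounded.fix (· < ·) fun ν ih =>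
      Φ fun n => insert (top n) (range fun μ : Iio ν => ih μ.1 μ.2 n), fun ν => ?_⟩
    rw [IsWellFounded.fix_eq]
    congr 1
    funext n
    rw [image_eq_range]
  set S : (succ (ℵ₀ : Cardinal.{0})).ord.ToType → ℕ → Set Ordinal.{w} :=
    fun ν n => insert (top n) ((fun μ => H μ n) '' Iio ν)
  have hS : ∀ ν n, (S ν n).Countable ∧ top n ∈ S ν n := fun ν n => by
    refine ⟨Countable.insert _ (Countable.image ?_ _), mem_insert _ _⟩
    rw [← le_aleph0_iff_set_countable]
    simpa [lt_succ_iff] using mk_Iio_lt ν (by simp)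
  obtain ⟨i, hi⟩ := exists_forall_lt hc0 (T := (succ (ℵ₀ : Cardinal.{0})).ord.ToType)
    (by
      have : succ (ℵ₀ : Cardinal.{u}) ≤ 2 ^ (ℵ₀ : Cardinal.{u}) := succ_le_of_lt (cantor _)
      simpa [Cardinal.lift_succ] using this.trans hc) (fun ν => i₀ (S ν))
  set P : (succ (ℵ₀ : Cardinal.{0})).ord.ToType → ℕ → Ordinal.{w} :=
    fun ν n => leastAbove (S ν n) (f i n)
  have hub : ∀ ν, ∀ᶠ n in atTop, f i n ≤ H ν n := fun ν => by
    rw [hH ν]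
    exact (hΦ (S ν) (hS ν)).1 i
  have hlt : ∀ ν, ∃ᶠ n in atTop, H ν n < P ν n := fun ν => by
    rw [hH ν]
    exact (hΦ (S ν) (hS ν)).2 i (hi ν).le
  have hanti : ∀ n μ ν, μ ≤ ν → P ν n ≤ P μ n := fun n μ ν hμν => by
    have h := leastAbove_mem (hS μ n).2 (htop i n)
    refine leastAbove_le (insert_subset_insert (image_mono ?_) h.1) h.2
    exact Iio_subset_Iio hμν
  have hne := nonempty_succ_ord_toType (ℵ₀ : Cardinal.{0})
  have hmin : ∀ n, ∃ μ, ∀ ν, P μ n ≤ P ν n := fun n =>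
    ⟨_, fun ν => Function.argmin_le (fun ν => P ν n) ν⟩
  choose m hm using hmin
  obtain ⟨μ, hμ⟩ := exists_forall_lt le_rfl (by simp) m
  obtain ⟨ν, hν⟩ := exists_forall_lt le_rfl (by simp) fun _ : Unit => μ
  obtain ⟨n, h1, h2⟩ := ((hlt μ).and_eventually (hub μ)).exists
  have h3 : P ν n ≤ H μ n :=
    leastAbove_le (mem_insert_of_mem _ ⟨μ, hν (), rfl⟩) h2
  exact (((hanti n _ _ (hμ n).le).trans (hm n ν)).trans h3).not_gt h1

/-- Over `2 ^ ℵ₀ ≤ c`, least upper bounds of sequences of length `c⁺` are exact. -/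
theorem IsLeastUpperBound.exists_le {c : Cardinal.{u}} (hc : 2 ^ ℵ₀ ≤ c)
    {f : (succ c).ord.ToType → ℕ → Ordinal.{w}}
    (hf : ∀ i j, i < j → ∀ᶠ n in atTop, f i n ≤ f j n)
    {h : ℕ → Ordinal.{w}} (hh : IsLeastUpperBound f h)
    {g : ℕ → Ordinal.{w}} (hg : ∀ᶠ n in atTop, g n < h n) :
    ∃ i, ∀ᶠ n in atTop, g n ≤ f i n := by
  classical
  have hc0 : ℵ₀ ≤ c := (cantor _).le.trans hc
  by_contra hno
  obtain ⟨B, hB⟩ := exists_cofinal_fiber hc0 (T := Set ℕ)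
    (by simpa using hc) id (fun i => {n | g n ≤ f i n}) (fun i => ⟨_, rfl⟩)
  have key := hh.least (fun n => if n ∈ B then h n else g n) fun i => by
    obtain ⟨j, hij, rfl⟩ := hB i
    filter_upwards [hh.upper i, hf i j hij] with n h1 h2
    split_ifs with h3
    · exact h1
    · exact h2.trans (not_le.1 h3).le
  have hne := nonempty_succ_ord_toType c
  obtain ⟨j, -, rfl⟩ := hB hne.some
  refine hno ⟨j, ?_⟩
  filter_upwards [key, hg] with n h1 h2
  by_contra h3
  simp only [if_neg h3] at h1
  exact h1.not_gt h2

theorem exists_cofinal_family {M : Type u} [Nonempty M] {o : Ordinal.{u}} (ho : o.cof ≤ #M) :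
    ∃ k : M → Ordinal.{u}, (0 < o → ∀ x, k x < o) ∧ ∀ y < o, ∃ x, y ≤ k x := by
  rcases eq_or_ne o 0 with rfl | h0
  · exact ⟨0, by simp, by simp⟩
  obtain ⟨s, hs, hs'⟩ := exists_cof_eq o.ToType
  have hne : Nonempty s := by
    have : Nonempty o.ToType := nonempty_toType_iff.2 h0
    obtain ⟨y, hy, -⟩ := hs this.some
    exact ⟨⟨y, hy⟩⟩
  rw [cof_toType] at hs'
  rw [← hs', Cardinal.le_def] at ho
  obtain ⟨e⟩ := ho
  refine ⟨fun x => (ToType.toOrd (Function.invFun e x).1).1, fun _ x => (ToType.toOrd _).2,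
    fun y hy => ?_⟩
  obtain ⟨z, hz, hyz⟩ := hs (ToType.mk ⟨y, hy⟩)
  refine ⟨e ⟨z, hz⟩, ?_⟩
  beta_reduce
  rw [Function.leftInverse_invFun e.injective]
  have := ToType.mk.symm.monotone hyz
  rw [OrderIso.symm_apply_apply] at this
  exact this

/-- For a strong limit `l`, the values of a least upper bound of a strictly increasing sequence of
length `l⁺` have cofinalities tending to at least `l`. -/
theorem IsLeastUpperBound.eventually_lt_cof {l : Cardinal.{u}} (hl : l.IsStrongLimit)
    (hl0 : ℵ₀ < l) {f : (succ l).ord.ToType → ℕ → Ordinal.{u}}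
    (hf : ∀ i j, i < j → ∀ᶠ n in atTop, f i n < f j n)
    {h : ℕ → Ordinal.{u}} (hh : IsLeastUpperBound f h) {μ : Cardinal.{u}} (hμ : μ < l) :
    ∀ᶠ n in atTop, μ < (h n).cof := by
  classical
  have hlt : ∀ i, ∀ᶠ n in atTop, f i n < h n := fun i => by
    obtain ⟨j, hj⟩ := exists_forall_lt hl0.le (by simpa using hl0.le.trans' one_le_aleph0)
      fun _ : Unit => i
    filter_upwards [hf i j (hj ()), hh.upper j] with n h1 h2 using h1.trans_le h2
  set κ := max μ ℵ₀
  have hκ0 : ℵ₀ ≤ κ := le_max_right _ _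
  have : Nonempty κ.out := by
    rw [← mk_ne_zero_iff, mk_out]
    exact (aleph0_pos.trans_le hκ0).ne'
  have hk : ∀ n, ∃ k : κ.out → Ordinal.{u}, (h n).cof ≤ μ →
      (0 < h n → ∀ x, k x < h n) ∧ ∀ y < h n, ∃ x, y ≤ k x := fun n => by
    by_cases hn : (h n).cof ≤ μ
    · obtain ⟨k, hk⟩ := exists_cofinal_family (M := κ.out) (o := h n)
        (by rw [mk_out]; exact hn.trans (le_max_left _ _))
      exact ⟨k, fun _ => hk⟩
    · exact ⟨0, fun h => absurd h hn⟩
  choose k hk using hk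
  have hT : #(ℕ → κ.out) ≤ l := by
    have hpow : #(ℕ → κ.out) = κ ^ ℵ₀ := by simp
    rw [hpow]
    calc κ ^ ℵ₀ ≤ κ ^ κ := power_le_power_left (aleph0_pos.trans_le hκ0).ne' hκ0
      _ = 2 ^ κ := power_self_eq hκ0
      _ ≤ l := (hl.isStrongPrelimit (max_lt hμ hl0)).le
  have hp : ∀ i, ∃ t : ℕ → κ.out, ∀ n, (h n).cof ≤ μ → f i n < h n → f i n ≤ k n (t n) :=
    fun i => by
      have : ∀ n, ∃ x, (h n).cof ≤ μ → f i n < h n → f i n ≤ k n x := fun n => by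
        by_cases hn : (h n).cof ≤ μ ∧ f i n < h n
        · obtain ⟨x, hx⟩ := (hk n hn.1).2 _ hn.2
          exact ⟨x, fun _ _ => hx⟩
        · exact ⟨Classical.arbitrary _, fun h1 h2 => absurd ⟨h1, h2⟩ hn⟩
      choose t ht using this
      exact ⟨t, ht⟩
  choose p hp using hp
  obtain ⟨t, ht⟩ := exists_cofinal_fiber hl0.le (by simpa using hT) id p fun i => ⟨_, rfl⟩
  have key := hh.least (fun n => if (h n).cof ≤ μ then k n (t n) else h n) fun i => by
    obtain ⟨j, hij, rfl⟩ := ht i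
    filter_upwards [hf i j hij, hlt j] with n h1 h2
    split_ifs with h3
    · exact h1.le.trans (hp j n h3 h2)
    · exact (h1.trans h2).le
  have hne := nonempty_succ_ord_toType l
  filter_upwards [key, hlt hne.some] with n h1 h2
  by_contra! h3
  rw [if_pos h3] at h1
  exact h1.not_gt ((hk n h3).1 (pos_of_gt h2) _)

/-- `lam` is a strictly increasing sequence of regular cardinals converging to `l`. -/
structure IsRegularApprox (l : Cardinal.{u}) (lam : ℕ → Cardinal.{u}) : Prop where
  strictMono : StrictMono lam
  isRegular : ∀ n, (lam n).IsRegular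
  lt : ∀ n, lam n < l
  exists_lt : ∀ c < l, ∃ n, c < lam n

theorem IsRegularApprox.iSup_eq {l : Cardinal.{u}} {lam : ℕ → Cardinal.{u}}
    (h : IsRegularApprox l lam) : ⨆ n, lam n = l := by
  refine le_antisymm (ciSup_le' fun n => (h.lt n).le) (le_of_forall_lt fun c hc => ?_)
  obtain ⟨n, hn⟩ := h.exists_lt c hc
  exact hn.trans_le (le_ciSup Cardinal.bddAbove_of_small n)

theorem exists_isRegularApprox {l : Cardinal.{u}} (hl : l.IsStrongLimit) (hl0 : ℵ₀ < l)
    (hcof : l.ord.cof = ℵ₀) : ∃ lam, IsRegularApprox l lam := by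
  obtain ⟨k, hk, hk'⟩ := exists_cofinal_family (M := ULift.{u} ℕ) (o := l.ord) (by simp [hcof])
  have hpos : 0 < l.ord := by
    rw [lt_ord, card_zero]
    exact aleph0_pos.trans hl0
  set c : ℕ → Cardinal.{u} := fun n => (k ⟨n⟩).card
  have hc : ∀ n, c n < l := fun n => lt_ord.1 (hk hpos ⟨n⟩)
  let lam : ℕ → Cardinal.{u} := fun n =>
    Nat.rec (succ (max ℵ₀ (c 0))) (fun n x => succ (max x (c (n + 1)))) n
  have hs : ∀ {x}, x < l → succ x < l := fun hx => hl.isSuccLimit.succ_lt hx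
  have h0 : ∀ n, ℵ₀ ≤ lam n := fun n => by
    induction n with
    | zero => exact (le_max_left _ _).trans (le_succ _)
    | succ n ih => exact ih.trans ((le_max_left _ _).trans (le_succ _))
  refine ⟨lam, strictMono_nat_of_lt_succ fun n => ?_, fun n => ?_, fun n => ?_, fun x hx => ?_⟩
  · exact (le_max_left _ _).trans_lt (lt_succ _)
  · cases n with
    | zero => exact isRegular_succ (le_max_left _ _)
    | succ n => exact isRegular_succ ((h0 n).trans (le_max_left _ _))
  · induction n with
    | zero => exact hs (max_lt hl0 (hc 0))
    | succ n ih => exact hs (max_lt ih (hc _))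
  · obtain ⟨⟨n⟩, hn⟩ := hk' x.ord (ord_lt_ord.2 hx)
    have h1 : x ≤ c n := ord_le.1 hn
    refine ⟨n, h1.trans_lt ?_⟩
    cases n with
    | zero => exact (le_max_right _ _).trans_lt (lt_succ _)
    | succ n => exact (le_max_right _ _).trans_lt (lt_succ _)

/-- Families of at most `l` functions in the product are bounded modulo finite sets. -/
theorem IsRegularApprox.exists_bound {l : Cardinal.{u}} {lam : ℕ → Cardinal.{u}}
    (h : IsRegularApprox l lam) {T : Type u} (hT : #T ≤ l) (G : T → ℕ → Ordinal.{u})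
    (hG : ∀ t n, G t n < (lam n).ord) :
    ∃ g : ℕ → Ordinal.{u}, (∀ n, g n < (lam n).ord) ∧ ∀ t, ∀ᶠ n in atTop, G t n < g n := by
  obtain ⟨o, ho, hol⟩ : ∃ o : T → Ordinal.{u}, Function.Injective o ∧ ∀ t, o t < l.ord := by
    rw [← mk_ord_toType l, Cardinal.le_def] at hT
    obtain ⟨e⟩ := hT
    exact ⟨fun t => (ToType.toOrd (e t)).1,
      Subtype.val_injective.comp (ToType.mk.symm.injective.comp e.injective),
      fun t => (ToType.toOrd (e t)).2⟩
  have hcard : ∀ m, #{t | o t < (lam m).ord} ≤ lam m := fun m => by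
    have := Cardinal.mk_le_of_injective
      (f := fun t : ULift.{u + 1} {t | o t < (lam m).ord} =>
        (⟨o t.down, t.down.2⟩ : Iio (lam m).ord)) (fun a b hab => by
          exact ULift.ext _ _ (Subtype.ext (ho (congrArg Subtype.val hab))))
    rw [Cardinal.mk_Iio_ordinal, card_ord, mk_uLift] at this
    exact Cardinal.lift_le.1 this
  refine ⟨fun n => Nat.casesOn n 0 fun m =>
    ⨆ t : {t | o t < (lam m).ord}, G t (m + 1) + 1, fun n => ?_, fun t => ?_⟩
  · cases n with
    | zero => exact (h.isRegular 0).ord_pos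
    | succ m =>
      refine iSup_add_one_lt_of_lt_cof ?_ fun t => hG _ _
      rw [(h.isRegular _).cof_ord]
      exact (hcard m).trans_lt (h.strictMono m.lt_succ_self)
  · obtain ⟨N, hN⟩ := h.exists_lt _ (lt_ord.1 (hol t))
    filter_upwards [eventually_gt_atTop N] with n hn
    obtain ⟨m, rfl⟩ : ∃ m, n = m + 1 := ⟨n - 1, by omega⟩
    have hm : o t < (lam m).ord := lt_ord.2 (hN.trans_le (h.strictMono.monotone (by omega)))
    exact (lt_add_one _).trans_le (le_ciSup (f := fun t : {t | o t < (lam m).ord} =>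
      G t (m + 1) + 1) Ordinal.bddAbove_of_small ⟨t, hm⟩)

/-- Every sequence of length `l⁺` in the product is dominated, termwise, by a strictly increasing
one. -/
theorem IsRegularApprox.exists_increasing {l : Cardinal.{u}} {lam : ℕ → Cardinal.{u}}
    (h : IsRegularApprox l lam) (G : (succ l).ord.ToType → ℕ → Ordinal.{u})
    (hG : ∀ i n, G i n < (lam n).ord) :
    ∃ g : (succ l).ord.ToType → ℕ → Ordinal.{u}, (∀ i n, g i n < (lam n).ord) ∧
      (∀ i j, i < j → ∀ᶠ n in atTop, g i n < g j n) ∧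
      ∀ i, ∀ᶠ n in atTop, G i n < g i n := by
  classical
  have hl0 : ℵ₀ ≤ l := (h.isRegular 0).aleph0_le.trans (h.lt 0).le
  have hIic : ∀ i : (succ l).ord.ToType, #(Iic i) ≤ l := fun i => by
    have := mk_Iic_lt i (by simp) (by simpa using hl0.trans (le_succ l))
    rw [mk_ord_toType] at this
    exact lt_succ_iff.1 this
  have step : ∀ (i : (succ l).ord.ToType) (K : (succ l).ord.ToType → ℕ → Ordinal.{u}),
      ∃ g : ℕ → Ordinal.{u}, (∀ μ ≤ i, ∀ n, K μ n < (lam n).ord) →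
        (∀ n, g n < (lam n).ord) ∧ ∀ μ ≤ i, ∀ᶠ n in atTop, K μ n < g n := fun i K => by
    by_cases hK : ∀ μ ≤ i, ∀ n, K μ n < (lam n).ord
    · obtain ⟨g, hg, hg'⟩ := h.exists_bound (hIic i) (fun t => K t) fun t => hK t t.2
      exact ⟨g, fun _ => ⟨hg, fun μ hμ => hg' ⟨μ, hμ⟩⟩⟩
    · exact ⟨0, fun h => absurd h hK⟩
  choose Φ hΦ using step
  obtain ⟨g, hg⟩ : ∃ g : (succ l).ord.ToType → ℕ → Ordinal.{u},
      ∀ i, g i = Φ i fun μ => if μ < i then g μ else G i := by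
    refine ⟨IsWellFounded.fix (· < ·) fun i ih =>
      Φ i fun μ => if hμ : μ < i then ih μ hμ else G i, fun i => ?_⟩
    rw [IsWellFounded.fix_eq]
    simp only [dite_eq_ite]
  have hlt : ∀ i n, g i n < (lam n).ord := fun i => by
    induction i using WellFoundedLT.induction with
    | ind i ih =>
      rw [hg i]
      refine (hΦ i _ fun μ _ n => ?_).1
      split_ifs with hμ
      · exact ih μ hμ n
      · exact hG i n
  have key : ∀ i, ∀ μ ≤ i, ∀ᶠ n in atTop, (if μ < i then g μ else G i) n < g i n := fun i => by
    conv in g i _ => rw [hg i]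
    refine (hΦ i _ fun μ _ n => ?_).2
    split_ifs with hμ
    · exact hlt μ n
    · exact hG i n
  refine ⟨g, hlt, fun i j hij => ?_, fun i => ?_⟩
  · simpa [hij] using key j i hij.le
  · simpa using key i i le_rfl

/-- The true cofinality of some product of regular cardinals converging to `l`, modulo finite sets,
is `l⁺`. -/
theorem exists_scale {l : Cardinal.{u}} (hl : l.IsStrongLimit) (hl0 : ℵ₀ < l)
    (hcof : l.ord.cof = ℵ₀) :
    ∃ lam, IsRegularApprox l lam ∧ ∃ g : (succ l).ord.ToType → ℕ → Ordinal.{u},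
      (∀ i n, g i n < (lam n).ord) ∧
      (∀ i j, i < j → ∀ᶠ n in atTop, g i n < g j n) ∧
      ∀ φ : ℕ → Ordinal.{u}, (∀ n, φ n < (lam n).ord) →
        ∃ i, ∀ᶠ n in atTop, φ n < g i n := by
  classical
  obtain ⟨lam, hlam⟩ := exists_isRegularApprox hl hl0 hcof
  obtain ⟨f, hflam, hf, -⟩ := hlam.exists_increasing 0 fun _ n => (hlam.isRegular n).ord_pos
  have hc : 2 ^ ℵ₀ ≤ l := (hl.isStrongPrelimit hl0).le
  have hf' : ∀ i j, i < j → ∀ᶠ n in atTop, f i n ≤ f j n := fun i j hij =>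
    (hf i j hij).mono fun _ => le_of_lt
  obtain ⟨h, hh⟩ := exists_isLeastUpperBound hc hf' fun i n => (hflam i n).le
  have hcoflt : ∀ᶠ n in atTop, (h n).cof < l := by
    filter_upwards [hh.least _ fun i => Eventually.of_forall fun n => (hflam i n).le] with n hn
    refine (cof_le_card _).trans_lt ((card_le_card hn).trans_lt ?_)
    rw [card_ord]
    exact hlam.lt n
  obtain ⟨N, hN⟩ := eventually_atTop.1
    (hcoflt.and (hh.eventually_lt_cof hl hl0 hf hl0))
  have : NoMaxOrder (Iio l) := ⟨fun a => ⟨⟨_, hl.isSuccLimit.succ_lt a.2⟩, lt_succ a.1⟩⟩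
  have htend : Tendsto (fun n => (⟨(h (n + N)).cof, (hN _ (by omega)).1⟩ : Iio l))
      atTop atTop := by
    refine tendsto_atTop.2 fun b => ?_
    filter_upwards [(tendsto_add_atTop_nat N).eventually
      (hh.eventually_lt_cof hl hl0 hf b.2)] with n hn using hn.le
  obtain ⟨ψ, hψ, hψ'⟩ := strictMono_subseq_of_tendsto_atTop htend
  set θ : ℕ → ℕ := fun k => ψ k + N
  have hθ : StrictMono θ := fun a b hab => Nat.add_lt_add_right (hψ hab) N
  have hθN : ∀ k, N ≤ θ k := fun k => Nat.le_add_left _ _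
  have happrox : IsRegularApprox l fun k => (h (θ k)).cof := by
    refine ⟨fun a b hab => hψ' hab, fun k => isRegular_cof ?_, fun k => (hN _ (hθN k)).1,
      fun x hx => ?_⟩
    · rw [← Ordinal.one_lt_cof_iff]
      exact one_lt_aleph0.trans (hN _ (hθN k)).2
    · exact (hθ.tendsto_atTop.eventually (hh.eventually_lt_cof hl hl0 hf hx)).exists
  choose s hs using fun k => exists_isFundamentalSeq (o := h (θ k)) rfl
  have hG : ∀ i k, ∃ x, x < (h (θ k)).cof.ord ∧ ∀ hlt : f i (θ k) < h (θ k),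
      ∀ hx : x < (h (θ k)).cof.ord, f i (θ k) ≤ s k ⟨x, hx⟩ := fun i k => by
    by_cases hlt : f i (θ k) < h (θ k)
    · obtain ⟨_, ⟨y, rfl⟩, hy⟩ := (hs k).isCofinal_range ⟨_, hlt⟩
      exact ⟨y.1, y.2, fun _ _ => hy⟩
    · exact ⟨0, (happrox.isRegular k).ord_pos, fun h => absurd h hlt⟩
  choose G hG hG' using hG
  obtain ⟨g, hg, hgmono, hGg⟩ := happrox.exists_increasing G hG
  refine ⟨_, happrox, g, hg, hgmono, fun φ hφ => ?_⟩
  have hex : ∃ φ' : ℕ → Ordinal.{u}, ∀ k, φ' (θ k) = s k ⟨φ k, hφ k⟩ :=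
    ⟨Function.extend θ (fun k => (s k ⟨φ k, hφ k⟩).1) 0, fun k => hθ.injective.extend_apply _ _ _⟩
  obtain ⟨φ', hφ'⟩ := hex
  obtain ⟨i, hi⟩ := hh.exists_le hc hf'
    (g := fun n => if ∃ k, θ k = n then φ' n else 0) (by
      filter_upwards [eventually_ge_atTop N] with n hn
      split_ifs with hk
      · obtain ⟨k, rfl⟩ := hk
        rw [hφ']
        exact (s k _).2
      · rw [← Ordinal.cof_pos]
        exact aleph0_pos.trans (hN n hn).2)
  obtain ⟨j, hj⟩ := exists_forall_lt hl0.le (by simpa using hl0.le.trans' one_le_aleph0)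
    fun _ : Unit => i
  obtain ⟨j', hj'⟩ := exists_forall_lt hl0.le (by simpa using hl0.le.trans' one_le_aleph0)
    fun _ : Unit => j
  refine ⟨j, ?_⟩
  filter_upwards [hθ.tendsto_atTop.eventually hi, hθ.tendsto_atTop.eventually (hf i j (hj ())),
    hθ.tendsto_atTop.eventually (hf j j' (hj' ())),
    hθ.tendsto_atTop.eventually (hh.upper j'), hGg j] with k h1 h2 h3 h4 h5
  rw [if_pos ⟨k, rfl⟩, hφ'] at h1
  have h6 : s k ⟨φ k, hφ k⟩ < s k ⟨G j k, hG j k⟩ :=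
    (h1.trans_lt h2).trans_le (hG' j k (h3.trans_le h4) (hG j k))
  have h7 : φ k < G j k := (hs k).strictMono.lt_iff_lt.1 h6
  exact h7.trans h5

end TrueCofinality


/-- Shelah's lemma: if `l` is a singular strong limit cardinal of cofinality `ω`, then
there is a strictly increasing sequence `⟨λ_i : i < ω⟩` of regular cardinals with
supremum `l` such that the true cofinality of `∏_{i<ω} λ_i / fin` is `l⁺`, witnessed
by a `<*`-increasing and `<*`-cofinal sequence `⟨g_α : α < l⁺⟩`. -/
theorem stmt_0 (l : Cardinal) (hsl : l.IsStrongLimit)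
    (hsing : Cardinal.aleph0 < l) (hcof : l.ord.cof = Cardinal.aleph0) :
    ∃ lam : ℕ → Cardinal,
      StrictMono lam ∧
      (∀ i, (lam i).IsRegular) ∧
      (⨆ i, lam i) = l ∧
      ∃ g : Ordinal → ℕ → Ordinal,
        (∀ α, α < (Order.succ l).ord → ∀ i, g α i < (lam i).ord) ∧
        (∀ α β, α < β → β < (Order.succ l).ord →
          ∀ᶠ i in Filter.cofinite, g α i < g β i) ∧
        (∀ f : ℕ → Ordinal, (∀ i, f i < (lam i).ord) →
          ∃ α, α < (Order.succ l).ord ∧ ∀ᶠ i in Filter.cofinite, f i < g α i) := by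
  obtain ⟨lam, hlam, g, hg, hmono, hcofinal⟩ := TrueCofinality.exists_scale hsl hsing hcof
  classical
  refine ⟨lam, hlam.strictMono, hlam.isRegular, hlam.iSup_eq,
    fun α => if h : α < (Order.succ l).ord then g (Ordinal.ToType.mk ⟨α, h⟩) else 0,
    fun α hα i => ?_, fun α β hαβ hβ => ?_, fun f hf => ?_⟩
  · simpa only [dif_pos hα] using hg _ i
  · simp only [dif_pos hβ, dif_pos (hαβ.trans hβ), Nat.cofinite_eq_atTop]
    exact hmono _ _ (Ordinal.ToType.mk.strictMono hαβ)
  · obtain ⟨i, hi⟩ := hcofinal f hf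
    have hlt : (Ordinal.ToType.toOrd i).1 < (Order.succ l).ord := (Ordinal.ToType.toOrd i).2
    refine ⟨(Ordinal.ToType.toOrd i).1, hlt, ?_⟩
    simp only [dif_pos hlt, Nat.cofinite_eq_atTop]
    have hmk : Ordinal.ToType.mk ⟨(Ordinal.ToType.toOrd i).1, hlt⟩ = i :=
      Ordinal.ToType.mk.apply_symm_apply i
    rwa [hmk]
end

section
/- Let λ be a singular strong limit cardinal of cofinality ω and let κ < λ be any cardinal. Then there exists a strictly increasing sequence ⟨λ_i : i < ω⟩ of regular cardinals with supremum λ such that κ < λ_i for every i < ω, together with a sequence ⟨g_α : α < λ⁺⟩ in ∏_{i<ω} λ_i that is <*-increasing and <*-cofinal in ∏_{i<ω} λ_i. -/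
open Cardinal Filter Set

universe u

/-- The pointwise least value of a member of `K` that is at least `f`. -/
noncomputable def leastAbove (K : Set (ℕ → Ordinal.{u})) (f : ℕ → Ordinal.{u}) (i : ℕ) :
    Ordinal.{u} :=
  sInf {x | ∃ k ∈ K, x = k i ∧ f i ≤ x}

theorem leastAbove_mem {K : Set (ℕ → Ordinal.{u})} {f : ℕ → Ordinal.{u}} {i : ℕ}
    (h : ∃ k ∈ K, f i ≤ k i) :
    ∃ k ∈ K, leastAbove K f i = k i ∧ f i ≤ leastAbove K f i := by
  obtain ⟨k, hk, hle⟩ := h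
  exact csInf_mem (s := {x | ∃ k ∈ K, x = k i ∧ f i ≤ x}) ⟨k i, k, hk, rfl, hle⟩

theorem leastAbove_le {K : Set (ℕ → Ordinal.{u})} {f k : ℕ → Ordinal.{u}} {i : ℕ}
    (hk : k ∈ K) (h : f i ≤ k i) : leastAbove K f i ≤ k i :=
  csInf_le' ⟨k, hk, rfl, h⟩

theorem leastAbove_mono {K : Set (ℕ → Ordinal.{u})} {f f' : ℕ → Ordinal.{u}} {i : ℕ}
    (h : ∃ k ∈ K, f' i ≤ k i) (hf : f i ≤ f' i) :
    leastAbove K f i ≤ leastAbove K f' i := by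
  obtain ⟨k, hk, he, hle⟩ := leastAbove_mem h
  rw [he] at hle ⊢
  exact leastAbove_le hk (hf.trans hle)

section

variable {l : Cardinal.{u}} {I : Type u} [LinearOrder I]

theorem eventually_le_of_le {f : I → ℕ → Ordinal.{u}}
    (hf : ∀ a b, a < b → ∀ᶠ i in cofinite, f a i < f b i) {a b : I} (hab : a ≤ b) :
    ∀ᶠ i in cofinite, f a i ≤ f b i := by
  rcases hab.eq_or_lt with rfl | h
  · exact Eventually.of_forall fun _ => le_rfl
  · exact (hf a b h).mono fun _ h => h.le

/-- Along an increasing sequence of functions, the least values above it taken from a small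
family `K` are eventually constant modulo finite sets. -/
theorem leastAbove_eventuallyEq [Nonempty I]
    (hI : ∀ (ι : Type u) (a : ι → I), #ι ≤ l → ∃ b, ∀ j, a j < b)
    {f : I → ℕ → Ordinal.{u}} (hf : ∀ a b, a < b → ∀ᶠ i in cofinite, f a i < f b i)
    {K : Set (ℕ → Ordinal.{u})} {ι : Type u} {k : ι → ℕ → Ordinal.{u}}
    (hk : K ⊆ range k) (hι : #ι ^ ℵ₀ ≤ l) (hK : ∀ a i, ∃ x ∈ K, f a i ≤ x i) :
    ∃ a, ∀ b, a ≤ b → leastAbove K (f b) =ᶠ[cofinite] leastAbove K (f a) := by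
  have h1 : ∀ a i, ∃ j, leastAbove K (f a) i = k j i := fun a i => by
    obtain ⟨x, hx, he, -⟩ := leastAbove_mem (hK a i)
    obtain ⟨j, rfl⟩ := hk hx
    exact ⟨j, he⟩
  choose c hc using h1
  have h2 : ∀ s : ℕ → ι, ∃ d, (∀ b, c b = s → b ≤ d) ∨ ∀ b, ∃ b', b ≤ b' ∧ c b' = s := by
    intro s
    by_cases h : ∃ d, ∀ b, c b = s → b ≤ d
    · exact ⟨_, Or.inl h.choose_spec⟩
    · push Not at h
      exact ⟨Classical.arbitrary I, Or.inr fun b => let ⟨b', h1, h2⟩ := h b; ⟨b', h2.le, h1⟩⟩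
  choose d hd using h2
  obtain ⟨a, ha⟩ := hI (ℕ → ι) d (by simpa using hι)
  refine ⟨a, fun b hab => ?_⟩
  rcases hd (c a) with h | h
  · exact absurd (h a rfl) (ha _).not_ge
  · obtain ⟨b', hb', he⟩ := h b
    filter_upwards [eventually_le_of_le hf hab, eventually_le_of_le hf hb'] with i h1 h2
    refine le_antisymm ((leastAbove_mono (hK b' i) h2).trans ?_) (leastAbove_mono (hK b i) h1)
    rw [hc, hc, he]

/-- A `<*`-increasing sequence with highly directed index set has an exact upper bound. -/
theorem exists_exact_upper_bound [Nonempty I]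
    (hI : ∀ (ι : Type u) (a : ι → I), #ι ≤ l → ∃ b, ∀ j, a j < b) (hl : 2 ^ ℵ₀ ≤ l)
    {f : I → ℕ → Ordinal.{u}} (hf : ∀ a b, a < b → ∀ᶠ i in cofinite, f a i < f b i)
    {m : ℕ → Ordinal.{u}} (hm : ∀ a i, f a i < m i) :
    ∃ h : ℕ → Ordinal.{u}, (∀ i, h i ≤ m i) ∧ (∀ a, ∀ᶠ i in cofinite, f a i < h i) ∧
      ∀ g : ℕ → Ordinal.{u}, (∀ᶠ i in cofinite, g i < h i) →
        ∃ a, ∀ᶠ i in cofinite, g i < f a i := by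
  classical
  by_contra! H
  let W : Type u := (2 ^ ℵ₀ : Cardinal.{u}).ord.ToType
  have hW : #W = 2 ^ ℵ₀ := by simp [W]
  have : Infinite W := by
    rw [Cardinal.infinite_iff, hW]; exact (cantor _).le
  have hWo : #(Option W) ^ ℵ₀ ≤ l := by
    rw [mk_option, hW, add_one_eq (cantor _).le, ← power_mul, aleph0_mul_aleph0]
    exact hl
  let P : Set (ℕ → Ordinal.{u}) → (ℕ → Ordinal.{u}) → Prop := fun K g =>
    ∃ a, ∀ b, a ≤ b → ∃ᶠ i in cofinite, f b i ≤ g i ∧ g i < leastAbove K (f b) i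
  have key : ∀ (K : Set (ℕ → Ordinal.{u})) (k : Option W → ℕ → Ordinal.{u}),
      K ⊆ range k → m ∈ K → ∃ g, P K g := by
    intro K k hk hmK
    have hK : ∀ a i, ∃ x ∈ K, f a i ≤ x i := fun a i => ⟨m, hmK, (hm a i).le⟩
    obtain ⟨a, ha⟩ := leastAbove_eventuallyEq hI hf hk hWo hK
    obtain ⟨g, hg, hg'⟩ := H (leastAbove K (f a)) (fun i => leastAbove_le hmK (hm a i).le) (by
      intro b
      obtain ⟨b', hb'⟩ := hI PUnit (fun _ => max a b) (by
        simpa using (one_le_aleph0.trans (cantor _).le).trans hl)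
      have hb' := hb' ⟨⟩
      filter_upwards [hf b b' ((le_max_right _ _).trans_lt hb'),
        ha b' ((le_max_left _ _).trans hb'.le)] with i h1 h2
      obtain ⟨k, -, -, h3⟩ := leastAbove_mem (hK b' i)
      exact h1.trans_le (h3.trans h2.le))
    refine ⟨g, a, fun b hb => ?_⟩
    have := hg' b
    refine (this.and_eventually (hg.and (ha b hb))).mono ?_
    rintro i ⟨h1, h2, h3⟩
    exact ⟨h1, h2.trans_eq h3.symm⟩
  let pick : Set (ℕ → Ordinal.{u}) → (ℕ → Ordinal.{u}) := fun K =>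
    if h : ∃ g, P K g then h.choose else m
  let G : W → ℕ → Ordinal.{u} := wellFounded_lt.fix fun w rec =>
    pick (insert m {x | ∃ (v : W) (hv : v < w), x = rec v hv})
  let K : W → Set (ℕ → Ordinal.{u}) := fun w => insert m (G '' Iio w)
  have hG : ∀ w, G w = pick (K w) := by
    intro w
    change wellFounded_lt.fix _ w = _
    rw [WellFounded.fix_eq]
    congr 2
    ext x
    constructor
    · rintro ⟨v, hv, rfl⟩
      exact ⟨v, hv, rfl⟩
    · rintro ⟨v, hv, rfl⟩
      exact ⟨v, hv, rfl⟩
  have hP : ∀ w, P (K w) (G w) := by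
    intro w
    have h : ∃ g, P (K w) g := by
      refine key (K w) (fun o => o.elim m G) ?_ (mem_insert _ _)
      rintro x (rfl | ⟨v, -, rfl⟩)
      · exact ⟨none, rfl⟩
      · exact ⟨some v, rfl⟩
    rw [hG]
    simp only [pick, dif_pos h]
    exact h.choose_spec
  choose a ha using hP
  obtain ⟨b, hb⟩ := hI W a (hW.trans_le hl)
  choose i hi using fun w => (ha w b (hb w).le).exists
  obtain ⟨n, hn⟩ := exists_infinite_fiber (fun w : W => (ULift.up (i w) : ULift.{u} ℕ))
    (by rw [hW]; simpa using cantor ℵ₀)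
  have hanti : StrictAnti fun w : (fun w : W => (ULift.up (i w) : ULift.{u} ℕ)) ⁻¹' {n} =>
      G w n.down := by
    rintro ⟨v, rfl⟩ ⟨w, hw⟩ hvw
    have hw : i w = i v := congrArg ULift.down hw
    have h1 := hi v
    have h2 := hi w
    rw [hw] at h2
    exact h2.2.trans_le (leastAbove_le (mem_insert_of_mem _ ⟨v, hvw, rfl⟩) h1.1)
  have := hanti.wellFoundedGT
  exact (Finite.of_wellFoundedLT_wellFoundedGT _).not_infinite hn

/-- Every ordinal `o` has a monotone cofinal sequence of length `o.cof.ord`. -/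
theorem exists_monotone_cofinal (o : Ordinal.{u}) :
    ∃ e : o.cof.ord.ToType → Ordinal.{u}, Monotone e ∧ (∀ t, e t < o) ∧
      ∀ x < o, ∃ t, x ≤ e t := by
  obtain ⟨s, hs, hs'⟩ := Ordinal.exists_ord_cof_eq o.ToType
  rw [Ordinal.cof_toType, ← Ordinal.type_toType o.cof.ord, Ordinal.type_eq] at hs'
  obtain ⟨r⟩ := hs'
  let r : s ≃o o.cof.ord.ToType := OrderIso.ofRelIsoLT r
  refine ⟨fun t => ((r.symm t : o.ToType).toOrd : Ordinal), ?_, fun t => ?_, fun x hx => ?_⟩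
  · intro a b hab
    have : r.symm a ≤ r.symm b := r.symm.monotone hab
    exact Ordinal.ToType.mk.symm.monotone this
  · exact (Ordinal.ToType.toOrd _).2
  · obtain ⟨y, hy, hxy⟩ := hs (Ordinal.ToType.mk ⟨x, hx⟩)
    refine ⟨r ⟨y, hy⟩, ?_⟩
    have := Ordinal.ToType.mk.symm.monotone hxy
    rw [OrderIso.symm_apply_apply] at this
    simp only [OrderIso.symm_apply_apply]
    exact this

theorem add_one_power_aleph0_le (hl : l.IsStrongLimit) (hl' : ℵ₀ < l) {θ : Cardinal.{u}}
    (hθ : θ < l) : (θ + 1) ^ ℵ₀ ≤ l := by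
  have h : θ + ℵ₀ < l := add_lt_of_lt hl'.le hθ hl'
  calc (θ + 1) ^ ℵ₀ ≤ (2 ^ (θ + ℵ₀)) ^ ℵ₀ := by
        refine power_le_power_right (le_trans ?_ (cantor _).le)
        gcongr
        exact one_le_aleph0
    _ = 2 ^ (θ + ℵ₀) := by
        rw [← power_mul, mul_aleph0_eq]
        exact self_le_add_left _ _
    _ ≤ l := (hl.isStrongPrelimit h).le

/-- The cofinalities of the values of an exact upper bound converge to `l`. -/
theorem eventually_lt_cof_of_exact [Nonempty I]
    (hI : ∀ (ι : Type u) (a : ι → I), #ι ≤ l → ∃ b, ∀ j, a j < b)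
    (hl : l.IsStrongLimit) (hl' : ℵ₀ < l)
    {f : I → ℕ → Ordinal.{u}} (hf : ∀ a b, a < b → ∀ᶠ i in cofinite, f a i < f b i)
    {m : ℕ → Ordinal.{u}} (hm : ∀ a i, f a i < m i) {h : ℕ → Ordinal.{u}}
    (hub : ∀ a, ∀ᶠ i in cofinite, f a i < h i)
    (hex : ∀ g : ℕ → Ordinal.{u}, (∀ᶠ i in cofinite, g i < h i) →
        ∃ a, ∀ᶠ i in cofinite, g i < f a i) {θ : Cardinal.{u}} (hθ : θ < l) :
    ∀ᶠ i in cofinite, θ < (h i).cof := by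
  classical
  by_contra hfreq
  have hfreq : ∃ᶠ i in cofinite, (h i).cof ≤ θ := by
    simpa only [Filter.Frequently, not_le] using hfreq
  have hc : ∀ i, ∃ c : θ.ord.ToType → Ordinal.{u}, (h i).cof ≤ θ → 0 < h i →
      (∀ t, c t < h i) ∧ ∀ x < h i, ∃ t, x ≤ c t := by
    intro i
    by_cases hi : (h i).cof ≤ θ ∧ 0 < h i
    · obtain ⟨e, -, he, he'⟩ := exists_monotone_cofinal (h i)
      obtain ⟨t, -⟩ := he' 0 hi.2
      have : Nonempty (h i).cof.ord.ToType := ⟨t⟩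
      have hle : #(h i).cof.ord.ToType ≤ #θ.ord.ToType := by simpa using hi.1
      obtain ⟨φ⟩ := hle
      refine ⟨fun t => e (Function.invFun φ t), fun _ _ => ⟨fun t => he _, fun x hx => ?_⟩⟩
      obtain ⟨t, ht⟩ := he' x hx
      exact ⟨φ t, ht.trans_eq (congrArg e (Function.leftInverse_invFun φ.injective t).symm)⟩
    · exact ⟨fun _ => 0, fun h1 h2 => absurd ⟨h1, h2⟩ hi⟩
  choose c hc using hc
  let k : Option θ.ord.ToType → ℕ → Ordinal.{u} := fun o => o.elim m fun t i => c i t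
  have hK : ∀ a i, ∃ x ∈ range k, f a i ≤ x i := fun a i => ⟨m, ⟨none, rfl⟩, (hm a i).le⟩
  obtain ⟨a, ha⟩ := leastAbove_eventuallyEq hI hf subset_rfl
    (by simpa using add_one_power_aleph0_le hl hl' hθ) hK
  let p := leastAbove (range k) (f a)
  have hpos : ∀ᶠ i in cofinite, 0 < h i := (hub a).mono fun i hi => zero_le.trans_lt hi
  obtain ⟨b, hb⟩ := hex (fun i => if p i < h i then p i else 0) (by
    filter_upwards [hpos] with i hi
    split_ifs with h1 <;> assumption)
  have hev : ∀ᶠ i in cofinite, h i ≤ p i := by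
    filter_upwards [hb, eventually_le_of_le hf (le_max_right a b), ha _ (le_max_left a b)]
      with i h1 h2 h3
    by_contra! hlt
    rw [if_pos hlt] at h1
    obtain ⟨-, -, -, h4⟩ := leastAbove_mem (hK (max a b) i)
    rw [h3] at h4
    exact absurd (h1.trans_le (h2.trans h4)) (lt_irrefl _)
  obtain ⟨i, h1, h2, h3, h4⟩ := (hfreq.and_eventually (hpos.and (hev.and (hub a)))).exists
  obtain ⟨hc1, hc2⟩ := hc i h1 h2
  obtain ⟨t, ht⟩ := hc2 _ h4
  have : p i ≤ c i t := leastAbove_le (k := k (some t)) ⟨some t, rfl⟩ ht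
  exact absurd (this.trans_lt (hc1 t)) h3.not_gt

/-- In `∏ lam i`, any `l` many functions have a common `<*`-upper bound. -/
theorem exists_eventually_bound {lam : ℕ → Cardinal.{u}} (hmono : StrictMono lam)
    (hreg : ∀ i, (lam i).IsRegular) (hsup : ∀ θ < l, ∃ i, θ < lam i)
    {ι : Type u} (hι : #ι ≤ l) (F : ι → ℕ → Ordinal.{u}) (hF : ∀ j i, F j i < (lam i).ord) :
    ∃ g : ℕ → Ordinal.{u}, (∀ i, g i < (lam i).ord) ∧
      ∀ j, ∀ᶠ i in cofinite, F j i < g i := by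
  rw [← mk_ord_toType l] at hι
  obtain ⟨c⟩ := hι
  let A : ℕ → Type u := fun i => {j : ι // 0 < i ∧ ((c j).toOrd : Ordinal) < (lam (i - 1)).ord}
  have hA : ∀ i, #(A i) < lam i := by
    rintro (_ | n)
    · have : IsEmpty (A 0) := ⟨fun j => j.2.1.false⟩
      simpa using (hreg 0).pos
    · refine lt_of_le_of_lt ?_ (hmono n.lt_succ_self)
      rw [← mk_ord_toType (lam n)]
      refine mk_le_of_injective
        (f := fun j : A (n + 1) => Ordinal.ToType.mk ⟨((c j.1).toOrd : Ordinal), j.2.2⟩) ?_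
      intro x y hxy
      have := congrArg Subtype.val (Ordinal.ToType.mk.injective hxy)
      exact Subtype.ext (c.injective (Ordinal.ToType.mk.symm.injective (Subtype.ext this)))
  refine ⟨fun i => ⨆ j : A i, F j.1 i + 1, fun i => ?_, fun j => ?_⟩
  · refine Ordinal.iSup_add_one_lt_of_lt_cof ?_ fun j => hF _ _
    rw [(hreg i).cof_ord]
    exact hA i
  · obtain ⟨n, hn⟩ := hsup _ (lt_ord.1 (mem_Iio.1 (c j).toOrd.2))
    rw [Nat.cofinite_eq_atTop]
    filter_upwards [eventually_gt_atTop n] with i hi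
    refine Ordinal.lt_iSup_add_one (f := fun j : A i => F j.1 i) ⟨j, by omega, ?_⟩
    exact lt_ord.2 (hn.trans_le (hmono.monotone (by omega)))

/-- A sequence of functions in `∏ lam i` is pointwise `<*`-below some `<*`-increasing sequence. -/
theorem exists_increasing_above [WellFoundedLT I] (hIio : ∀ a : I, #(Iio a) ≤ l) (hl : ℵ₀ ≤ l)
    {lam : ℕ → Cardinal.{u}} (hmono : StrictMono lam)
    (hreg : ∀ i, (lam i).IsRegular) (hsup : ∀ θ < l, ∃ i, θ < lam i)
    (F : I → ℕ → Ordinal.{u}) (hF : ∀ a i, F a i < (lam i).ord) :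
    ∃ g : I → ℕ → Ordinal.{u}, (∀ a i, g a i < (lam i).ord) ∧
      (∀ a b, a < b → ∀ᶠ i in cofinite, g a i < g b i) ∧
      ∀ a, ∀ᶠ i in cofinite, F a i < g a i := by
  let S := {g : ℕ → Ordinal.{u} // ∀ i, g i < (lam i).ord}
  have hstep : ∀ (a : I) (r : ∀ b, b < a → S), ∃ g : S,
      (∀ b hb, ∀ᶠ i in cofinite, (r b hb).1 i < g.1 i) ∧ ∀ᶠ i in cofinite, F a i < g.1 i := by
    intro a r
    obtain ⟨g, hg, hg'⟩ := exists_eventually_bound hmono hreg hsup (ι := Option (Iio a))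
      (by rw [mk_option]; exact add_le_of_le hl (hIio a) (one_le_aleph0.trans hl))
      (fun o => o.elim (F a) fun b => (r b.1 b.2).1)
      (by rintro (_ | b); exacts [hF a, (r b.1 b.2).2])
    exact ⟨⟨g, hg⟩, fun b hb => hg' (some ⟨b, hb⟩), hg' none⟩
  choose step hstep using hstep
  let G : I → S := wellFounded_lt.fix step
  have hG : ∀ a, G a = step a fun b _ => G b := fun a => wellFounded_lt.fix_eq step a
  refine ⟨fun a => (G a).1, fun a => (G a).2, fun a b hab => ?_, fun a => ?_⟩
  · simp only [hG b]
    exact (hstep b _).1 a hab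
  · simp only [hG a]
    exact (hstep a _).2

theorem exists_strictMono_comp {c : ℕ → Cardinal.{u}} (hc : ∀ θ < l, ∀ᶠ i in atTop, θ < c i)
    (hlt : ∀ i, c i < l) {κ : Cardinal.{u}} (hκ : κ < l) :
    ∃ φ : ℕ → ℕ, StrictMono φ ∧ StrictMono (c ∘ φ) ∧ ∀ n, κ < c (φ n) := by
  have h : ∀ i, ∃ j, i < j ∧ max κ (c i) < c j := fun i =>
    ((eventually_gt_atTop i).and (hc _ (max_lt hκ (hlt i)))).exists
  choose s hs hs' using h
  refine ⟨fun n => s^[n + 1] 0, strictMono_nat_of_lt_succ fun n => ?_,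
    strictMono_nat_of_lt_succ fun n => ?_, fun n => ?_⟩
  · rw [Function.iterate_succ_apply' s (n + 1)]
    exact hs _
  · simp only [Function.comp_apply]
    rw [Function.iterate_succ_apply' s (n + 1)]
    exact (le_max_right _ _).trans_lt (hs' _)
  · simp only [Function.iterate_succ_apply']
    exact (le_max_left _ _).trans_lt (hs' _)

/-- A singular strong limit cardinal of cofinality `ω` is a limit of regular cardinals. -/
theorem exists_regular_seq (hl : l.IsStrongLimit) (hl' : ℵ₀ < l) (hcof : l.ord.cof = ℵ₀) :
    ∃ c : ℕ → Cardinal.{u}, (∀ i, (c i).IsRegular) ∧ (∀ i, c i < l) ∧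
      ∀ θ < l, ∀ᶠ i in atTop, θ < c i := by
  have h := exists_monotone_cofinal l.ord
  rw [hcof, ord_aleph0] at h
  obtain ⟨e, he, hlt, hcf⟩ := h
  let t : ℕ → Ordinal.omega0.ToType := fun n => Ordinal.ToType.mk ⟨n, Ordinal.natCast_lt_omega0 n⟩
  refine ⟨fun n => Order.succ (max ℵ₀ (e (t n)).card), fun n => isRegular_succ (le_max_left _ _),
    fun n => hl.isSuccLimit.succ_lt (max_lt hl' (lt_ord.1 (hlt _))), fun θ hθ => ?_⟩
  obtain ⟨x, hx⟩ := hcf θ.ord (ord_lt_ord.2 hθ)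
  obtain ⟨n, hn⟩ := Ordinal.lt_omega0.1 (mem_Iio.1 x.toOrd.2)
  filter_upwards [eventually_ge_atTop n] with i hi
  refine Order.lt_succ_of_le (le_trans ?_ (le_max_right _ _))
  rw [← ord_le]
  refine hx.trans (he ?_)
  rw [← OrderIso.symm_apply_le]
  change (x.toOrd : Ordinal) ≤ i
  rw [hn]
  exact_mod_cast hi

end

theorem exists_gt_of_mk_le {l : Cardinal.{u}} (hl : ℵ₀ ≤ l) {ι : Type u}
    (a : ι → (Order.succ l).ord.ToType) (hι : #ι ≤ l) : ∃ b, ∀ j, a j < b := by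
  have hlt : ⨆ j, ((a j).toOrd : Ordinal) + 1 < (Order.succ l).ord := by
    refine Ordinal.iSup_add_one_lt_of_lt_cof ?_ fun j => (a j).toOrd.2
    rw [(isRegular_succ hl).cof_ord]
    exact Order.lt_succ_of_le hι
  refine ⟨Ordinal.ToType.mk ⟨_, hlt⟩, fun j => ?_⟩
  rw [← OrderIso.symm_apply_lt]
  exact Ordinal.lt_iSup_add_one (f := fun j => ((a j).toOrd : Ordinal)) j

/-- A sequence with exact upper bound `h` induces a `<*`-cofinal family in the product of the
cofinalities of any subsequence of `h`. -/
theorem exists_cofinal_of_exact {I : Type u} {f : I → ℕ → Ordinal.{u}} {h : ℕ → Ordinal.{u}}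
    (hub : ∀ a, ∀ᶠ i in cofinite, f a i < h i)
    (hex : ∀ g : ℕ → Ordinal.{u}, (∀ᶠ i in cofinite, g i < h i) →
        ∃ a, ∀ᶠ i in cofinite, g i < f a i) {φ : ℕ → ℕ} (hφ : Function.Injective φ)
    (hpos : ∀ n, 0 < h (φ n)) (hpos' : ∀ᶠ i in cofinite, 0 < h i) :
    ∃ F : I → ℕ → Ordinal.{u}, (∀ a n, F a n < (h (φ n)).cof.ord) ∧
      ∀ v : ℕ → Ordinal.{u}, (∀ n, v n < (h (φ n)).cof.ord) →
        ∃ a, ∀ᶠ n in cofinite, v n < F a n := by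
  choose e he hlt hcf using fun n => exists_monotone_cofinal (h (φ n))
  have hF : ∀ a n, ∃ t, f a (φ n) < h (φ n) → f a (φ n) ≤ e n t := by
    intro a n
    by_cases hlt : f a (φ n) < h (φ n)
    · exact (hcf n _ hlt).imp fun t ht _ => ht
    · exact (hcf n 0 (hpos n)).imp fun t _ h => absurd h hlt
  choose F hF using hF
  refine ⟨fun a n => (F a n).toOrd, fun a n => (F a n).toOrd.2, fun v hv => ?_⟩
  obtain ⟨a, ha⟩ := hex (Function.extend φ (fun n => e n (Ordinal.ToType.mk ⟨v n, hv n⟩)) 0) (by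
    filter_upwards [hpos'] with i hi
    by_cases hr : ∃ n, φ n = i
    · obtain ⟨n, rfl⟩ := hr
      rw [hφ.extend_apply]
      exact hlt _ _
    · rwa [Function.extend_apply' _ _ _ hr])
  refine ⟨a, ?_⟩
  filter_upwards [hφ.tendsto_cofinite.eventually ha, hφ.tendsto_cofinite.eventually (hub a)]
    with n h1 h2
  rw [hφ.extend_apply] at h1
  by_contra! hle
  refine (h1.trans_le (hF a n h2)).not_ge (he n ?_)
  rw [← OrderIso.symm_apply_le]
  exact hle


/-- Shelah's lemma with a lower bound: if `l` is a singular strong limit cardinal of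
cofinality `ω` and `κ < l`, then there is a strictly increasing sequence of regular
cardinals `⟨λ_i : i < ω⟩` with supremum `l`, all above `κ`, together with a
`<*`-increasing and `<*`-cofinal sequence `⟨g_α : α < l⁺⟩` in `∏_{i<ω} λ_i`. -/
theorem stmt_1 (l κ : Cardinal) (hsl : l.IsStrongLimit)
    (hsing : Cardinal.aleph0 < l) (hcof : l.ord.cof = Cardinal.aleph0)
    (hκ : κ < l) :
    ∃ lam : ℕ → Cardinal,
      StrictMono lam ∧
      (∀ i, (lam i).IsRegular) ∧
      (⨆ i, lam i) = l ∧
      (∀ i, κ < lam i) ∧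
      ∃ g : Ordinal → ℕ → Ordinal,
        (∀ α, α < (Order.succ l).ord → ∀ i, g α i < (lam i).ord) ∧
        (∀ α β, α < β → β < (Order.succ l).ord →
          ∀ᶠ i in Filter.cofinite, g α i < g β i) ∧
        (∀ f : ℕ → Ordinal, (∀ i, f i < (lam i).ord) →
          ∃ α, α < (Order.succ l).ord ∧ ∀ᶠ i in Filter.cofinite, f i < g α i) := by
  classical
  obtain ⟨c, hcreg, hclt, hc⟩ := exists_regular_seq hsl hsing hcof
  obtain ⟨ψ, hψ, hψ', -⟩ := exists_strictMono_comp hc hclt hκ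
  let I := (Order.succ l).ord.ToType
  have hI : ∀ (ι : Type _) (a : ι → I), #ι ≤ l → ∃ b, ∀ j, a j < b := fun ι a =>
    exists_gt_of_mk_le hsing.le a
  have : Nonempty I := nonempty_ord_toType (Order.bot_lt_succ l).ne'
  have hIio : ∀ a : I, #(Iio a) ≤ l := fun a => Order.lt_succ_iff.1 (by
    simpa [I] using mk_Iio_lt a (by simp [I]))
  obtain ⟨f, hfm, hf, -⟩ := exists_increasing_above hIio hsing.le hψ' (fun i => hcreg _)
    (fun θ hθ => (hψ.tendsto_atTop.eventually (hc θ hθ)).exists) (fun _ _ => 0)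
    (fun _ i => (hcreg _).ord_pos)
  obtain ⟨h, hle, hub, hex⟩ :=
    exists_exact_upper_bound hI (hsl.isStrongPrelimit hsing).le hf hfm
  have hcofh : ∀ θ < l, ∀ᶠ i in atTop, θ < (h i).cof := fun θ hθ => by
    rw [← Nat.cofinite_eq_atTop]
    exact eventually_lt_cof_of_exact hI hsl hsing hf hfm hub hex hθ
  have hhlt : ∀ i, (h i).cof < l := fun i =>
    (Ordinal.cof_le_card _).trans_lt (((Ordinal.card_le_card (hle i)).trans_eq (card_ord _)).trans_lt
      (hclt _))
  obtain ⟨φ, hφ, hφ', hφκ⟩ := exists_strictMono_comp hcofh hhlt (max_lt hκ hsing)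
  have hreg : ∀ n, ((h (φ n)).cof).IsRegular := fun n =>
    isRegular_cof (Ordinal.one_lt_cof_iff.1
      (one_lt_aleph0.trans ((le_max_right _ _).trans_lt (hφκ n))))
  have hsup : ∀ θ < l, ∃ n, θ < (h (φ n)).cof := fun θ hθ =>
    (hφ.tendsto_atTop.eventually (hcofh θ hθ)).exists
  obtain ⟨F, hF, hFcof⟩ := exists_cofinal_of_exact hub hex hφ.injective
    (fun n => Ordinal.cof_pos.1 (hreg n).pos)
    ((hub (Classical.arbitrary I)).mono fun i hi => zero_le.trans_lt hi)
  obtain ⟨g, hg, hgmono, hgF⟩ := exists_increasing_above hIio hsing.le hφ' hreg hsup F hF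
  obtain ⟨G, hG⟩ : ∃ G : Ordinal → ℕ → Ordinal,
      ∀ α (hα : α ∈ Iio (Order.succ l).ord), G α = g (Ordinal.ToType.mk ⟨α, hα⟩) :=
    ⟨fun α => if hα : α ∈ Iio (Order.succ l).ord then g (Ordinal.ToType.mk ⟨α, hα⟩) else 0,
      fun _ hα => dif_pos hα⟩
  refine ⟨fun n => (h (φ n)).cof, hφ', hreg, ?_, fun n => (le_max_left _ _).trans_lt (hφκ n),
    G, ?_, ?_, ?_⟩
  · refine le_antisymm (ciSup_le' fun n => (hhlt _).le) (le_of_forall_lt fun θ hθ => ?_)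
    obtain ⟨n, hn⟩ := hsup θ hθ
    exact hn.trans_le (le_ciSup (f := fun n => (h (φ n)).cof) (bddAbove_of_small) n)
  · intro α hα i
    rw [hG α hα]
    exact hg _ i
  · intro α β hαβ hβ
    rw [hG β hβ, hG α (hαβ.trans hβ)]
    exact hgmono _ _ (Ordinal.ToType.mk.strictMono hαβ)
  · intro v hv
    obtain ⟨a, ha⟩ := hFcof v hv
    refine ⟨a.toOrd, a.toOrd.2, ?_⟩
    rw [hG _ a.toOrd.2, Subtype.coe_eta, Ordinal.ToType.toOrd, OrderIso.apply_symm_apply]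
    filter_upwards [ha, hgF a] with i h1 h2
    exact h1.trans h2
end
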